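/- arXiv:math/0402167 — 2 statements merged into one kernel-verified Lean document; each statement's English description precedes it below -/
import Mathlib

section
/- Let m ≥ 1 and let a_0, a_1, ..., a_m be real numbers with a_0 ≤ -1 and a_j ≤ -2 for 1 ≤ j ≤ m. With the sequences (p_j), (q_j) defined by the standard recursion, for every j with 1 ≤ j ≤ m one has q_{j-1} + (a_0+1)p_{j-1} ≠ 0 and -(q_j + (a_0+1)p_j)/(q_{j-1} + (a_0+1)p_{j-1}) = ⟨a_j, a_{j-1}, ..., a_2, a_1 + 1⟩ (for j = 1 the right-hand side is ⟨a_1 + 1⟩ = a_1 + 1). -/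
/-- The continued fraction: `cfrac a m k = ⟨a_{m-k}, …, a_m⟩`, so that
`⟨a_j, …, a_m⟩ = cfrac a m (m - j)`, with `⟨a_m⟩ = a_m` and
`⟨a_j, …, a_m⟩ = a_j - 1/⟨a_{j+1}, …, a_m⟩`. -/
noncomputable def cfrac (a : ℕ → ℝ) (m : ℕ) : ℕ → ℝ
  | 0 => a m
  | k + 1 => a (m - (k + 1)) - 1 / cfrac a m k

/-- `pseq a (j+2) = p_j`: `p_{-2} = -1`, `p_{-1} = 0`, `p_j = -a_j p_{j-1} - p_{j-2}`. -/
noncomputable def pseq (a : ℕ → ℝ) : ℕ → ℝ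
  | 0 => -1
  | 1 => 0
  | n + 2 => -a n * pseq a (n + 1) - pseq a n

/-- `qseq a (j+2) = q_j`: `q_{-2} = 0`, `q_{-1} = 1`, `q_j = -a_j q_{j-1} - q_{j-2}`. -/
noncomputable def qseq (a : ℕ → ℝ) : ℕ → ℝ
  | 0 => 0
  | 1 => 1
  | n + 2 => -a n * qseq a (n + 1) - qseq a n

/-- The combination `q_j + (a_0 + 1) p_j` is positive and nondecreasing from `j = -1` on. -/
lemma qseq_add_mul_pseq_pos_and_le (m : ℕ) (a : ℕ → ℝ)
    (ha : ∀ j, 1 ≤ j → j ≤ m → a j ≤ -2) (n : ℕ) (hn : n ≤ m) :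
    0 < qseq a (n + 1) + (a 0 + 1) * pseq a (n + 1) ∧
      qseq a (n + 1) + (a 0 + 1) * pseq a (n + 1) ≤
        qseq a (n + 2) + (a 0 + 1) * pseq a (n + 2) := by
  induction n with
  | zero => simp [qseq, pseq]
  | succ n ih =>
    obtain ⟨hpos, hle⟩ := ih (by lia)
    have h := ha (n + 1) (by lia) hn
    rw [qseq.eq_3 a (n + 1), pseq.eq_3 a (n + 1)]
    exact ⟨by linarith, by nlinarith⟩

/-- The tails of the reversed continued fraction are the negated ratios of consecutive
terms `q_j + (a_0 + 1) p_j`. -/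
lemma cfrac_reversed_tail (m : ℕ) (a : ℕ → ℝ)
    (ha : ∀ j, 1 ≤ j → j ≤ m → a j ≤ -2) (j k : ℕ) (hj : j ≤ m) (hk : k + 1 ≤ j) :
    cfrac (fun i => if i = j - 1 then a 1 + 1 else a (j - i)) (j - 1) k =
      -(qseq a (k + 3) + (a 0 + 1) * pseq a (k + 3)) /
        (qseq a (k + 2) + (a 0 + 1) * pseq a (k + 2)) := by
  induction k with
  | zero =>
    simp [cfrac, qseq, pseq]
    ring
  | succ k ih =>
    have h₁ := (qseq_add_mul_pseq_pos_and_le m a ha (k + 1) (by lia)).1.ne'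
    have h₂ := (qseq_add_mul_pseq_pos_and_le m a ha (k + 2) (by lia)).1.ne'
    rw [cfrac, ih (by lia), if_neg (by lia), show j - (j - 1 - (k + 1)) = k + 2 by lia,
      qseq.eq_3 a (k + 2), pseq.eq_3 a (k + 2)]
    simp only [add_assoc, Nat.reduceAdd] at h₁ h₂ ⊢
    field_simp
    ring

/-- For real `a_0 ≤ -1`, `a_j ≤ -2` (`1 ≤ j ≤ m`), and `1 ≤ j ≤ m`:
`q_{j-1} + (a_0+1) p_{j-1} ≠ 0` and
`-(q_j + (a_0+1) p_j)/(q_{j-1} + (a_0+1) p_{j-1}) = ⟨a_j, a_{j-1}, …, a_2, a_1 + 1⟩`.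
The reversed sequence `a_j, a_{j-1}, …, a_2, a_1 + 1` has `j` entries, indexed `0, …, j-1`
by `i ↦ a (j - i)` for `i < j - 1` and with last entry `a 1 + 1`; for `j = 1` the
right-hand side is just `a 1 + 1`. -/
theorem cf_reversed (m : ℕ) (hm : 1 ≤ m) (a : ℕ → ℝ)
    (ha0 : a 0 ≤ -1) (ha : ∀ j, 1 ≤ j → j ≤ m → a j ≤ -2) :
    ∀ j, 1 ≤ j → j ≤ m →
      qseq a (j + 1) + (a 0 + 1) * pseq a (j + 1) ≠ 0 ∧
      -(qseq a (j + 2) + (a 0 + 1) * pseq a (j + 2)) /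
          (qseq a (j + 1) + (a 0 + 1) * pseq a (j + 1)) =
        cfrac (fun i => if i = j - 1 then a 1 + 1 else a (j - i)) (j - 1) (j - 1) := by
  intro j hj hjm
  refine ⟨(qseq_add_mul_pseq_pos_and_le m a ha j hjm).1.ne', ?_⟩
  obtain ⟨k, rfl⟩ : ∃ k, j = k + 1 := ⟨j - 1, by lia⟩
  exact (cfrac_reversed_tail m a ha (k + 1) k hjm le_rfl).symm
end

section
/- Let p > q ≥ 1 be coprime integers and suppose -p/q = ⟨b_0, b_1, ..., b_l⟩ where b_0, ..., b_l are integers with b_j ≤ -2 for all 0 ≤ j ≤ l. Then for every integer e_0 ≥ 1, -(q + e_0 p)/(q + (e_0 - 1)p) = ⟨-2, ..., -2, b_0 - 1, b_1, ..., b_l⟩, where there are exactly e_0 - 1 entries equal to -2 in front of b_0 - 1. In particular, for e_0 = 1 this reads -(p + q)/q = ⟨b_0 - 1, b_1, ..., b_l⟩. -/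
/-- The continued fraction `⟨x_0, …, x_m⟩` of a list: `⟨x⟩ = x` and
`⟨x_0, x_1, …, x_m⟩ = x_0 - 1/⟨x_1, …, x_m⟩` (value `0` for the empty list). -/
noncomputable def cfL : List ℝ → ℝ
  | [] => 0
  | [x] => x
  | x :: y :: rest => x - 1 / cfL (y :: rest)

theorem cfL_cons_of_ne_nil (x : ℝ) {L : List ℝ} (hL : L ≠ []) :
    cfL (x :: L) = x - 1 / cfL L := by
  cases L with
  | nil => exact absurd rfl hL
  | cons y L => rfl

theorem cfL_sub_one_cons (x : ℝ) (L : List ℝ) : cfL ((x - 1) :: L) = cfL (x :: L) - 1 := by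
  cases L with
  | nil => rfl
  | cons y L => simp only [cfL]; ring

/-- Prepending `n` entries `-2` to an expansion of `-(p + q)/q`. -/
theorem cfL_replicate_neg_two_append {p q : ℝ} (hp : 0 < p) (hq : 0 < q) {L : List ℝ}
    (hL : L ≠ []) (h : cfL L = -(p + q) / q) (n : ℕ) :
    cfL (List.replicate n (-2) ++ L) = -(q + (n + 1) * p) / (q + n * p) := by
  induction n with
  | zero => simp [h, add_comm]
  | succ n ih =>
    rw [List.replicate_succ, List.cons_append, cfL_cons_of_ne_nil _ (by simp [hL]), ih]
    have h₁ : q + (n : ℝ) * p ≠ 0 := by positivity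
    have h₂ : q + ((n : ℝ) + 1) * p ≠ 0 := by positivity
    push_cast
    rw [neg_div, one_div, inv_neg, inv_div]
    field_simp
    ring

/-- `List.map (fun n => (n : ℝ))` on a list of integers elaborates through a monadic coercion
of the list. -/
theorem map_monadCoe_intCast (L : List ℤ) :
    (L.map fun n => (n : ℝ)) = List.map (Int.cast : ℤ → ℝ) L := by
  induction L with
  | nil => rfl
  | cons a L ih => simpa using ih

/-- Let `p > q ≥ 1` be coprime integers with `-p/q = ⟨b_0, b_1, …, b_l⟩`, where the `b_j`
are integers `≤ -2` (encoded as a nonempty list `B = [b_0, b_1, …, b_l]`). Then for every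
integer `e₀ ≥ 1`,
`-(q + e₀ p)/(q + (e₀ - 1) p) = ⟨-2, …, -2, b_0 - 1, b_1, …, b_l⟩`, with exactly `e₀ - 1`
entries `-2` in front of `b_0 - 1`; in particular for `e₀ = 1` this reads
`-(p + q)/q = ⟨b_0 - 1, b_1, …, b_l⟩`. -/
theorem cf_third_fiber_expansion (p q : ℤ) (hq : 1 ≤ q) (hpq : q < p)
    (hcop : Int.gcd p q = 1) (B : List ℤ) (hB : B ≠ [])
    (hBneg : ∀ x ∈ B, x ≤ -2)
    (hcf : -(p : ℝ) / (q : ℝ) = cfL (B.map fun n => (n : ℝ))) :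
    (∀ e₀ : ℕ, 1 ≤ e₀ →
      -((q : ℝ) + (e₀ : ℝ) * (p : ℝ)) / ((q : ℝ) + ((e₀ : ℝ) - 1) * (p : ℝ)) =
        cfL ((List.replicate (e₀ - 1) (-2 : ℤ) ++ (B.headI - 1) :: B.tail).map
          fun n => (n : ℝ))) ∧
    -((p : ℝ) + (q : ℝ)) / (q : ℝ) =
      cfL (((B.headI - 1) :: B.tail).map fun n => (n : ℝ)) := by
  simp only [map_monadCoe_intCast] at hcf ⊢
  have hq' : (0 : ℝ) < q := by exact_mod_cast hq
  have hp' : (0 : ℝ) < p := by exact_mod_cast (by linarith : (0 : ℤ) < p)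
  have hbase : cfL (((B.headI - 1) :: B.tail).map (Int.cast : ℤ → ℝ)) =
      -((p : ℝ) + (q : ℝ)) / (q : ℝ) := by
    cases B with
    | nil => exact absurd rfl hB
    | cons b B =>
      simp only [List.headI_cons, List.tail_cons, List.map_cons, Int.cast_sub, Int.cast_one,
        cfL_sub_one_cons] at hcf ⊢
      rw [← hcf]
      field_simp
      ring
  refine ⟨fun e₀ he₀ => ?_, hbase.symm⟩
  obtain ⟨n, rfl⟩ := Nat.exists_eq_add_of_le' he₀
  have h := cfL_replicate_neg_two_append hp' hq' (by simp) hbase n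
  rw [List.map_append, List.map_replicate, Nat.add_sub_cancel]
  push_cast at h ⊢
  rw [h, add_sub_cancel_right]
end
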